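/- arXiv:2502.10359 — 5 statements merged into one kernel-verified Lean document; each statement's English description precedes it below -/
import Mathlib

section
/- Let X and Y be finite nonempty types, H ⊆ Y^X a nonempty hypothesis class, and ℓ : Y × Y → [0,1] a metric loss function. Fix a distribution D over X, a sample size n ∈ ℕ, and a prior Λ, a probability distribution over H. Define the Bayesian learner A_Λ which, on a training sample S = ((x_1,y_1),…,(x_n,y_n)) consistent with some hypothesis of Λ-positive mass, outputs the posterior Λ|S: the conditional distribution of Λ on the set {h ∈ H : h(x_i) = y_i for all i ∈ [n]}. Then for every (possibly randomized) learner B mapping samples in (X×Y)^n to probability distributions over Y^X, the Λ-averaged expected error of A_Λ is at most twice that of B: E_{h*∼Λ} E_{S∼D_{h*}^n} E_{g∼A_Λ(S)}[L_{D,h*}(g)] ≤ 2 · E_{h*∼Λ} E_{S∼D_{h*}^n} E_{g∼B(S)}[L_{D,h*}(g)]. -/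
noncomputable section
open scoped ENNReal

/-- The true error `L_{D,h*}(g) = E_{x∼D}[ℓ(g(x), h*(x))]` of a predictor `g`. -/
def trueError {X Y : Type*} (ℓ : Y → Y → ℝ) (D : PMF X) (hstar g : X → Y) : ℝ :=
  ∑' x, (D x).toReal * ℓ (g x) (hstar x)

/-- Expected true error `E_{g∼P}[L_{D,h*}(g)]` of a randomized predictor `P`. -/
def pmfError {X Y : Type*} (ℓ : Y → Y → ℝ) (D : PMF X) (hstar : X → Y)
    (P : PMF (X → Y)) : ℝ :=
  ∑' g, (P g).toReal * trueError ℓ D hstar g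

/-- `E_{S∼D_{h*}^k}[F(S)]`: expectation of `F` over a sample of `k` i.i.d. points
drawn from `D` and labeled by `hstar`. -/
def sampleExp {X Y : Type*} (D : PMF X) (hstar : X → Y) (k : ℕ)
    (F : (Fin k → X × Y) → ℝ) : ℝ :=
  ∑' sx : Fin k → X, (∏ i, (D (sx i)).toReal) * F (fun i => (sx i, hstar (sx i)))

/-- The set of hypotheses in `H` consistent with the labeled sample `S`. -/
def Consistent {X Y : Type*} (H : Set (X → Y)) {n : ℕ} (S : Fin n → X × Y) :
    Set H :=
  {h | ∀ i, (h : X → Y) (S i).1 = (S i).2}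

lemma pmf_toReal_sum {α : Type*} [Fintype α] (P : PMF α) : ∑ a, (P a).toReal = 1 := by
  have h := P.tsum_coe
  rw [tsum_fintype] at h
  rw [← ENNReal.toReal_sum (fun a _ => P.apply_ne_top a), h]
  simp

lemma pmf_map_sum {α β : Type*} [Fintype α] [Fintype β] (P : PMF α) (f : α → β) (t : β → ℝ) :
    ∑ b, ((P.map f) b).toReal * t b = ∑ a, (P a).toReal * t (f a) := by
  classical
  have h : ∀ b, ((P.map f) b).toReal = ∑ a, if b = f a then (P a).toReal else 0 := by
    intro b
    rw [PMF.map_apply, tsum_fintype, ENNReal.toReal_sum]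
    · refine Finset.sum_congr rfl fun a _ => ?_
      by_cases hb : b = f a
      · rw [if_pos hb, if_pos hb]
      · rw [if_neg hb, if_neg hb]; rfl
    · intro a _
      by_cases hb : b = f a
      · rw [if_pos hb]; exact P.apply_ne_top a
      · rw [if_neg hb]; exact ENNReal.zero_ne_top
  simp only [h, Finset.sum_mul, ite_mul, zero_mul]
  rw [Finset.sum_comm]
  simp

/-- The core inequality: sampling from normalised weights is 2-optimal. -/
lemma core_two {ι κ : Type*} [Fintype ι] [Fintype κ] (w p : ι → ℝ) (b : κ → ℝ)
    (d : ι → ι → ℝ) (e : ι → κ → ℝ)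
    (hw : ∀ i, 0 ≤ w i) (hb : ∀ k, 0 ≤ b k) (hb1 : ∑ k, b k = 1)
    (hp0 : ∀ i, 0 ≤ p i) (hp1 : ∑ i, p i = 1)
    (hp : ∀ i j, w i * p j = w j * p i)
    (hd : ∀ i j k, d i j ≤ e i k + e j k) :
    ∑ i, w i * ∑ j, p j * d i j ≤ 2 * ∑ i, w i * ∑ k, b k * e i k := by
  have h1 : ∀ i j, d i j ≤ ∑ k, b k * e i k + ∑ k, b k * e j k := by
    intro i j
    calc d i j = ∑ k, b k * d i j := by rw [← Finset.sum_mul, hb1, one_mul]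
      _ ≤ ∑ k, (b k * e i k + b k * e j k) := by
        refine Finset.sum_le_sum fun k _ => ?_
        rw [← mul_add]
        exact mul_le_mul_of_nonneg_left (hd i j k) (hb k)
      _ = _ := Finset.sum_add_distrib
  set E : ι → ℝ := fun i => ∑ k, b k * e i k with hE
  calc ∑ i, w i * ∑ j, p j * d i j
      ≤ ∑ i, w i * ∑ j, p j * (E i + E j) := by
        refine Finset.sum_le_sum fun i _ => mul_le_mul_of_nonneg_left ?_ (hw i)
        exact Finset.sum_le_sum fun j _ => mul_le_mul_of_nonneg_left (h1 i j) (hp0 j)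
    _ = ∑ i, w i * E i + ∑ i, ∑ j, w i * p j * E j := by
        rw [← Finset.sum_add_distrib]
        refine Finset.sum_congr rfl fun i _ => ?_
        simp only [mul_add, Finset.sum_add_distrib]
        rw [← Finset.sum_mul, hp1, one_mul, Finset.mul_sum (f := fun j => p j * E j)]
        simp only [mul_assoc]
    _ = ∑ i, w i * E i + ∑ i, w i * E i := by
        congr 1
        rw [Finset.sum_comm]
        refine Finset.sum_congr rfl fun j _ => ?_
        simp only [hp _ j]
        rw [← Finset.sum_mul, ← Finset.mul_sum, hp1, mul_one]
    _ = _ := by ring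

/-- Splitting a prior average over samples by the label vector. -/
lemma avg_split {X Y : Type*} [Fintype X] [Fintype Y] [DecidableEq Y] (H : Set (X → Y))
    [Fintype H] (D : PMF X) (n : ℕ) (lam : H → ℝ) (F : H → (Fin n → X × Y) → ℝ) :
    ∑ h : H, lam h * sampleExp D (h : X → Y) n (F h) =
      ∑ sx : Fin n → X, (∏ i, (D (sx i)).toReal) * ∑ y : Fin n → Y, ∑ h : H,
        (if (fun i => (h : X → Y) (sx i)) = y then lam h else 0) * F h (fun i => (sx i, y i)) := by
  classical
  simp only [sampleExp, tsum_fintype, Finset.mul_sum]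
  rw [Finset.sum_comm]
  refine Finset.sum_congr rfl fun sx _ => ?_
  rw [Finset.sum_comm]
  refine Finset.sum_congr rfl fun h _ => ?_
  rw [Finset.sum_eq_single (fun i => (h : X → Y) (sx i))]
  · rw [if_pos rfl]; ring
  · intro y _ hy
    rw [if_neg (Ne.symm hy)]; ring
  · simp

/-- **The Bayesian learner is 2-optimal on average over the prior.** For finite `X`,
`Y`, a metric loss bounded in `[0,1]`, a fixed marginal `D` and a prior `Λ` over `H`,
the Bayesian learner `A` (outputting the posterior `Λ|S` whenever the consistency
event has positive `Λ`-mass) has `Λ`-averaged expected error at most twice that of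
any randomized learner `B`. -/
theorem bayesian_learner_factor_two {X Y : Type*} [Fintype X] [Fintype Y]
    [Nonempty X] [Nonempty Y]
    (H : Set (X → Y)) (hH : H.Nonempty)
    (ℓ : Y → Y → ℝ)
    (hsymm : ∀ y y', ℓ y y' = ℓ y' y)
    (htri : ∀ y y' y'', ℓ y y'' ≤ ℓ y y' + ℓ y' y'')
    (heq : ∀ y y', ℓ y y' = 0 ↔ y = y')
    (hbdd : ∀ y y', ℓ y y' ∈ Set.Icc (0 : ℝ) 1)
    (D : PMF X) (n : ℕ) (Λ : PMF H)
    (A : (Fin n → X × Y) → PMF H)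
    (hA : ∀ S : Fin n → X × Y, (∃ h ∈ Consistent H S, Λ h ≠ 0) →
      ∀ h : H, A S h =
        (Consistent H S).indicator (⇑Λ) h / ∑' h' : H, (Consistent H S).indicator (⇑Λ) h') :
    ∀ B : (Fin n → X × Y) → PMF (X → Y),
      (∑' hstar : H, (Λ hstar).toReal *
          sampleExp D (↑hstar) n (fun S => pmfError ℓ D (↑hstar) ((A S).map Subtype.val)))
        ≤ 2 * ∑' hstar : H, (Λ hstar).toReal *
            sampleExp D (↑hstar) n (fun S => pmfError ℓ D (↑hstar) (B S)) := by
  classical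
  intro B
  haveI : Fintype H := Fintype.ofFinite H
  simp only [tsum_fintype (L := SummationFilter.unconditional H)]
  rw [avg_split H D n (fun h => (Λ h).toReal)
      (fun h S => pmfError ℓ D (h : X → Y) ((A S).map Subtype.val)),
    avg_split H D n (fun h => (Λ h).toReal) (fun h S => pmfError ℓ D (h : X → Y) (B S)),
    Finset.mul_sum]
  refine Finset.sum_le_sum fun sx _ => ?_
  rw [mul_left_comm]
  refine mul_le_mul_of_nonneg_left ?_ (Finset.prod_nonneg fun i _ => ENNReal.toReal_nonneg)
  rw [Finset.mul_sum]
  refine Finset.sum_le_sum fun y _ => ?_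
  set S : Fin n → X × Y := fun i => (sx i, y i) with hS
  have hpe : ∀ (h : X → Y) (P : PMF (X → Y)),
      pmfError ℓ D h P = ∑ g, (P g).toReal * trueError ℓ D h g := by
    intro h P
    simp only [pmfError, tsum_fintype]
  simp only [hpe, pmf_map_sum]
  have hw : ∀ h : H, (if (fun i => (h : X → Y) (sx i)) = y then (Λ h).toReal else 0)
      = ((Consistent H S).indicator (⇑Λ) h).toReal := by
    intro h
    have hc : h ∈ Consistent H S ↔ (fun i => (h : X → Y) (sx i)) = y := by
      simp only [Consistent, Set.mem_setOf_eq, hS, funext_iff]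
    by_cases hh : (fun i => (h : X → Y) (sx i)) = y
    · rw [if_pos hh, Set.indicator_of_mem (hc.2 hh)]
    · rw [if_neg hh, Set.indicator_of_notMem (fun h' => hh (hc.1 h'))]; rfl
  simp only [hw]
  refine core_two (fun h : H => ((Consistent H S).indicator (⇑Λ) h).toReal)
    (fun h => (A S h).toReal) (fun g => (B S g).toReal)
    (fun i j => trueError ℓ D (i : X → Y) (j : X → Y))
    (fun i k => trueError ℓ D (i : X → Y) k)
    (fun _ => ENNReal.toReal_nonneg) (fun _ => ENNReal.toReal_nonneg) (pmf_toReal_sum _)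
    (fun _ => ENNReal.toReal_nonneg) (pmf_toReal_sum _) ?_ ?_
  · intro i j
    by_cases hex : ∃ h ∈ Consistent H S, Λ h ≠ 0
    · simp only [hA S hex, ENNReal.toReal_div]
      ring
    · have hz : ∀ h, (Consistent H S).indicator (⇑Λ) h = 0 := by
        intro h
        by_cases hm : h ∈ Consistent H S
        · rw [Set.indicator_of_mem hm]
          by_contra hne
          exact hex ⟨h, hm, hne⟩
        · exact Set.indicator_of_notMem hm _
      simp [hz]
  · intro i j k
    simp only [trueError, tsum_fintype]
    rw [← Finset.sum_add_distrib]
    refine Finset.sum_le_sum fun x _ => ?_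
    rw [← mul_add]
    refine mul_le_mul_of_nonneg_left ?_ ENNReal.toReal_nonneg
    have := htri ((j : X → Y) x) (k x) ((i : X → Y) x)
    rw [hsymm ((j : X → Y) x) (k x)] at this
    linarith
end
end

section
/- Let X and Y be finite nonempty types, H ⊆ Y^X a nonempty hypothesis class, and ℓ : Y × Y → [0,1] a metric loss function. Fix a sample size n ∈ ℕ. Then there exists a randomized proper distribution-fixed learner A, mapping each pair (D, S) of a distribution D over X and a labeled sample S ∈ (X×Y)^n to a probability distribution over H, such that for every distribution D over X: sup_{h*∈H} E_{S∼D_{h*}^n} E_{g∼A(D,S)}[L_{D,h*}(g)] ≤ 2 · inf_B sup_{h*∈H} E_{S∼D_{h*}^n} E_{g∼B(S)}[L_{D,h*}(g)], where the infimum ranges over all randomized learners B mapping samples in (X×Y)^n to probability distributions over Y^X (B may depend on D). That is, in the distribution-fixed model, H has a randomized proper learner attaining optimal worst-case expected error up to a factor of 2. -/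
noncomputable section
open scoped ENNReal

section Helpers

theorem sum_map_toReal {α β : Type*} [Fintype α] [Fintype β] (P : PMF α) (f : α → β)
    (F : β → ℝ) :
    ∑ b, ((P.map f) b).toReal * F b = ∑ a, (P a).toReal * F (f a) := by
  classical
  have h : ∀ b, ((P.map f) b).toReal = ∑ a, if b = f a then (P a).toReal else 0 := by
    intro b
    rw [PMF.map_apply, tsum_fintype, ENNReal.toReal_sum]
    · refine Finset.sum_congr rfl fun a _ => ?_
      split_ifs <;> simp
    · intro a _
      split_ifs
      · exact P.apply_ne_top a
      · simp
  simp_rw [h, Finset.sum_mul]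
  rw [Finset.sum_comm]
  refine Finset.sum_congr rfl fun a _ => ?_
  simp

theorem exists_pmf_of_simplex {α : Type*} [Fintype α] (q : α → ℝ)
    (hq : q ∈ stdSimplex ℝ α) : ∃ P : PMF α, ∀ a, (P a).toReal = q a := by
  refine ⟨PMF.ofFintype (fun a => ENNReal.ofReal (q a)) ?_, fun a => ?_⟩
  · rw [← ENNReal.ofReal_sum_of_nonneg (fun a _ => hq.1 a), hq.2]
    simp
  · simp [ENNReal.toReal_ofReal (hq.1 a)]

theorem pmf_mem_simplex {α : Type*} [Fintype α] (P : PMF α) :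
    (fun a => (P a).toReal) ∈ stdSimplex ℝ α := by
  refine ⟨fun a => ENNReal.toReal_nonneg, ?_⟩
  rw [← ENNReal.toReal_sum (fun a _ => P.apply_ne_top a), ← tsum_fintype (L := .unconditional _),
    P.tsum_coe]
  simp

/-- The worst-case risk attains its minimum over randomized learners. -/
theorem exists_opt {X Y : Type*} [Fintype X] [Fintype Y] [Nonempty Y]
    (H : Set (X → Y)) (hH : H.Nonempty) (ℓ : Y → Y → ℝ) (n : ℕ) (D : PMF X) :
    ∃ B₀ : (Fin n → X × Y) → PMF (X → Y), ∀ B : (Fin n → X × Y) → PMF (X → Y),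
      (⨆ hstar : H, sampleExp D (↑hstar) n (fun S => pmfError ℓ D (↑hstar) (B₀ S))) ≤
      ⨆ hstar : H, sampleExp D (↑hstar) n (fun S => pmfError ℓ D (↑hstar) (B S)) := by
  classical
  have : Nonempty H := hH.to_subtype
  let R : ((Fin n → X × Y) → (X → Y) → ℝ) → ℝ := fun q =>
    ⨆ hstar : H, sampleExp D (↑hstar) n
      (fun S => ∑ g, q S g * trueError ℓ D (↑hstar) g)
  have hR : Continuous R := by
    have : R = fun q => Finset.univ.sup' Finset.univ_nonempty (fun hstar : H =>
        sampleExp D (↑hstar) n (fun S => ∑ g, q S g * trueError ℓ D (↑hstar) g)) := by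
      funext q
      rw [Finset.sup'_univ_eq_ciSup]
    rw [this]
    refine Continuous.finset_sup'_apply _ fun h _ => ?_
    unfold sampleExp
    simp_rw [tsum_fintype]
    fun_prop
  have hK : IsCompact (Set.pi Set.univ
      (fun _ : Fin n → X × Y => stdSimplex ℝ (X → Y))) :=
    isCompact_univ_pi fun _ => isCompact_stdSimplex ℝ _
  have hne : (Set.pi Set.univ
      (fun _ : Fin n → X × Y => stdSimplex ℝ (X → Y))).Nonempty :=
    ⟨fun _ a => (PMF.pure (Classical.arbitrary (X → Y)) a).toReal,
      fun _ _ => pmf_mem_simplex _⟩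
  obtain ⟨q, hq, hmin⟩ := hK.exists_isMinOn hne hR.continuousOn
  choose B₀ hB₀ using fun S => exists_pmf_of_simplex (q S) (hq S (Set.mem_univ _))
  refine ⟨B₀, fun B => ?_⟩
  have h1 := hmin (show (fun S a => (B S a).toReal) ∈ _ from fun S _ => pmf_mem_simplex (B S))
  simpa only [R, Set.mem_ofPred_eq, pmfError, tsum_fintype, hB₀] using h1

theorem sampleExp_le_two_mul {X Y : Type*} [Fintype X] (D : PMF X) (h : X → Y) (n : ℕ)
    (F G : (Fin n → X × Y) → ℝ) (hFG : ∀ S, F S ≤ 2 * G S) :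
    sampleExp D h n F ≤ 2 * sampleExp D h n G := by
  classical
  unfold sampleExp
  rw [tsum_fintype, tsum_fintype, Finset.mul_sum]
  refine Finset.sum_le_sum fun sx _ => ?_
  have := mul_le_mul_of_nonneg_left (hFG (fun i => (sx i, h (sx i))))
    (Finset.prod_nonneg fun i (_ : i ∈ Finset.univ) => ENNReal.toReal_nonneg (a := D (sx i)))
  exact this.trans_eq (mul_left_comm _ _ _)

theorem pmfError_map_le {X Y : Type*} [Fintype X] [Fintype Y] (D : PMF X) (h : X → Y)
    (ℓ : Y → Y → ℝ) (P : PMF (X → Y)) (f : (X → Y) → (X → Y))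
    (hf : ∀ g, trueError ℓ D h (f g) ≤ 2 * trueError ℓ D h g) :
    pmfError ℓ D h (P.map f) ≤ 2 * pmfError ℓ D h P := by
  classical
  unfold pmfError
  rw [tsum_fintype, tsum_fintype, sum_map_toReal, Finset.mul_sum]
  refine Finset.sum_le_sum fun g _ => ?_
  have := mul_le_mul_of_nonneg_left (hf g) (ENNReal.toReal_nonneg (a := P g))
  exact this.trans_eq (mul_left_comm _ _ _)

theorem trueError_symm {X Y : Type*} (D : PMF X) (ℓ : Y → Y → ℝ)
    (hsymm : ∀ y y', ℓ y y' = ℓ y' y) (g h : X → Y) :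
    trueError ℓ D g h = trueError ℓ D h g := by
  unfold trueError
  exact tsum_congr fun x => by rw [hsymm]

theorem trueError_tri {X Y : Type*} [Fintype X] (D : PMF X) (ℓ : Y → Y → ℝ)
    (htri : ∀ y y' y'', ℓ y y'' ≤ ℓ y y' + ℓ y' y'') (h g p : X → Y) :
    trueError ℓ D h p ≤ trueError ℓ D g p + trueError ℓ D h g := by
  unfold trueError
  rw [tsum_fintype, tsum_fintype, tsum_fintype, ← Finset.sum_add_distrib]
  refine Finset.sum_le_sum fun x _ => ?_
  rw [← mul_add]
  exact mul_le_mul_of_nonneg_left (htri _ _ _) ENNReal.toReal_nonneg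

end Helpers

theorem fixed_D_learner {X Y : Type*} [Fintype X] [Fintype Y] [Nonempty Y]
    (H : Set (X → Y)) (hH : H.Nonempty)
    (ℓ : Y → Y → ℝ)
    (hsymm : ∀ y y', ℓ y y' = ℓ y' y)
    (htri : ∀ y y' y'', ℓ y y'' ≤ ℓ y y' + ℓ y' y'')
    (n : ℕ) (D : PMF X) :
    ∃ A : (Fin n → X × Y) → PMF H,
        (⨆ hstar : H,
            sampleExp D (↑hstar) n (fun S => pmfError ℓ D (↑hstar) ((A S).map Subtype.val)))
          ≤ 2 * ⨅ B : (Fin n → X × Y) → PMF (X → Y),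
              ⨆ hstar : H, sampleExp D (↑hstar) n (fun S => pmfError ℓ D (↑hstar) (B S)) := by
  classical
  have : Nonempty H := hH.to_subtype
  obtain ⟨B₀, hB₀⟩ := exists_opt H hH ℓ n D
  have hproj : ∀ g : X → Y, ∃ h : H, ∀ h' : H,
      trueError ℓ D g h ≤ trueError ℓ D g h' := fun g =>
    Finite.exists_min (fun h : H => trueError ℓ D g h)
  choose proj hproj using hproj
  have hte : ∀ (g : X → Y) (h : H),
      trueError ℓ D h (proj g) ≤ 2 * trueError ℓ D h g := by
    intro g h
    have h1 := hproj g h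
    have h2 := trueError_symm D ℓ hsymm g h
    have h3 := trueError_tri D ℓ htri h g (proj g)
    linarith
  refine ⟨fun S => (B₀ S).map proj, ?_⟩
  have hpe : ∀ (h : H) S, pmfError ℓ D h (((B₀ S).map (proj)).map Subtype.val) ≤
      2 * pmfError ℓ D h (B₀ S) := by
    intro h S
    rw [PMF.map_comp]
    exact pmfError_map_le D h ℓ (B₀ S) _ (fun g => hte g h)
  have hse : ∀ h : H, sampleExp D h n
      (fun S => pmfError ℓ D h (((B₀ S).map proj).map Subtype.val)) ≤
      2 * sampleExp D h n (fun S => pmfError ℓ D h (B₀ S)) :=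
    by
    intro h
    apply sampleExp_le_two_mul
    intro S
    exact hpe h S
  have hinf := le_ciInf hB₀
  have hsup : ∀ h : H, sampleExp D h n (fun S => pmfError ℓ D h (B₀ S)) ≤
      ⨆ hstar : H, sampleExp D (↑hstar) n (fun S => pmfError ℓ D (↑hstar) (B₀ S)) :=
    fun h => le_ciSup (f := fun hstar : H => sampleExp D (↑hstar) n
      (fun S => pmfError ℓ D (↑hstar) (B₀ S))) (Set.finite_range _).bddAbove h
  refine ciSup_le fun h => ?_
  have h1 := hse h
  have h2 := hsup h
  linarith

/-- **Optimal proper learning in the distribution-fixed model.** For finite `X, Y`,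
a nonempty class `H` and a metric loss bounded in `[0,1]`, there is a randomized
proper distribution-fixed learner `A` whose worst-case (over `h* ∈ H`) expected
error is, for every marginal `D`, at most twice the infimum over all randomized
learners `B` of their worst-case expected error. -/
theorem proper_distribution_fixed_two_optimal {X Y : Type*} [Fintype X] [Fintype Y]
    [Nonempty X] [Nonempty Y]
    (H : Set (X → Y)) (hH : H.Nonempty)
    (ℓ : Y → Y → ℝ)
    (hsymm : ∀ y y', ℓ y y' = ℓ y' y)
    (htri : ∀ y y' y'', ℓ y y'' ≤ ℓ y y' + ℓ y' y'')
    (heq : ∀ y y', ℓ y y' = 0 ↔ y = y')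
    (hbdd : ∀ y y', ℓ y y' ∈ Set.Icc (0 : ℝ) 1)
    (n : ℕ) :
    ∃ A : PMF X → (Fin n → X × Y) → PMF H,
      ∀ D : PMF X,
        (⨆ hstar : H,
            sampleExp D (↑hstar) n (fun S => pmfError ℓ D (↑hstar) ((A D S).map Subtype.val)))
          ≤ 2 * ⨅ B : (Fin n → X × Y) → PMF (X → Y),
              ⨆ hstar : H, sampleExp D (↑hstar) n (fun S => pmfError ℓ D (↑hstar) (B S)) := by
  choose A hA using fun D => fixed_D_learner H hH ℓ hsymm htri n D
  exact ⟨A, hA⟩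
end
end

section
/- Let (Z, 𝒜, μ) be a probability space, m ∈ ℕ, ε ≥ 0, and g : Z^m × Z → [0,1] a measurable function. Suppose that for every tuple S' ∈ Z^{m+1}, (1/(m+1)) · Σ_{i=1}^{m+1} g(S'_{−i}, S'_i) ≤ ε, where S'_{−i} denotes S' with its i-th coordinate removed. Then ∫ g(S, z) d(μ^{⊗m} ⊗ μ)(S, z) ≤ ε. (Interpreting g(S, z) as the loss incurred on test point z by a learner trained on sample S, this says: a learner whose transductive error is at most ε on every instance of size m+1 has expected error at most ε on i.i.d. samples of size m from any distribution.) -/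
open MeasureTheory

/-- **Transductive error bounds expected error.** If a `[0,1]`-valued measurable
loss `g(S, z)` has leave-one-out average at most `ε` on every tuple of size `m+1`,
then its expectation over an i.i.d. sample `S ∼ μ^{⊗m}` and an independent fresh
point `z ∼ μ` is at most `ε`. -/
theorem transductive_bounds_expected_error {Z : Type*} [MeasurableSpace Z]
    (μ : Measure Z) [IsProbabilityMeasure μ] (m : ℕ) (ε : ℝ) (hε : 0 ≤ ε)
    (g : (Fin m → Z) × Z → ℝ) (hg : Measurable g)
    (h01 : ∀ p, g p ∈ Set.Icc (0 : ℝ) 1)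
    (htrans : ∀ S' : Fin (m + 1) → Z,
      (∑ i : Fin (m + 1), g (S' ∘ i.succAbove, S' i)) / (m + 1) ≤ ε) :
    ∫ p, g p ∂((Measure.pi fun _ : Fin m => μ).prod μ) ≤ ε := by
  have hmp : ∀ i : Fin (m + 1), MeasurePreserving
      (fun S' : Fin (m + 1) → Z => ((S' ∘ i.succAbove, S' i) : (Fin m → Z) × Z))
      (Measure.pi fun _ : Fin (m + 1) => μ) ((Measure.pi fun _ : Fin m => μ).prod μ) := by
    intro i
    exact (Measure.measurePreserving_swap (μ := μ) (ν := Measure.pi fun _ : Fin m => μ)).comp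
      (measurePreserving_piFinSuccAbove (fun _ : Fin (m + 1) => μ) i)
  have hint : Integrable g ((Measure.pi fun _ : Fin m => μ).prod μ) := by
    refine Integrable.of_bound hg.aestronglyMeasurable 1 (Filter.Eventually.of_forall fun p => ?_)
    rw [Real.norm_eq_abs, abs_of_nonneg (h01 p).1]
    exact (h01 p).2
  have hinti : ∀ i : Fin (m + 1), Integrable (fun S' : Fin (m + 1) → Z =>
      g (S' ∘ i.succAbove, S' i)) (Measure.pi fun _ : Fin (m + 1) => μ) :=
    fun i => (hmp i).integrable_comp_of_integrable hint
  have heq : ∀ i : Fin (m + 1), ∫ S' : Fin (m + 1) → Z, g (S' ∘ i.succAbove, S' i)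
      ∂(Measure.pi fun _ : Fin (m + 1) => μ)
      = ∫ p, g p ∂((Measure.pi fun _ : Fin m => μ).prod μ) := by
    intro i
    rw [← (hmp i).map_eq, integral_map (hmp i).measurable.aemeasurable hg.aestronglyMeasurable]
  have hle := integral_mono
    ((integrable_finsetSum Finset.univ fun i _ => hinti i).div_const ((m : ℝ) + 1))
    (integrable_const (μ := Measure.pi fun _ : Fin (m + 1) => μ) ε) htrans
  have hm : (m : ℝ) + 1 ≠ 0 := by positivity
  rw [integral_div, integral_finsetSum _ fun i _ => hinti i] at hle
  simp only [heq] at hle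
  simpa [mul_div_cancel_left₀ _ hm] using hle
end

section
/- Let F be any set. Define the multiclass classification problem with domain X = F, label set Y = {⋆} ∪ 2^F (the power set of F together with a distinguished symbol ⋆), and hypothesis class H = { h_A : A ⊆ F, F \ A finite }, where h_A(x) = A if x ∈ A and h_A(x) = ⋆ if x ∉ A. Then, under the 0-1 loss, H is properly PAC learnable if and only if F is EMX-learnable. -/
noncomputable section
open scoped ENNReal Classical

/-- The true error under 0-1 loss: `L_{D,h*}(f) = P_{x∼D}(f(x) ≠ h*(x))`. -/
def trueError01 {X Y : Type*} (D : PMF X) (hstar f : X → Y) : ℝ :=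
  ∑' x, (D x).toReal * (if f x = hstar x then 0 else 1)

/-- The probability weight of an i.i.d. tuple `sx` of `k` draws from `D`. -/
def sampleProb {X : Type*} (D : PMF X) (k : ℕ) (sx : Fin k → X) : ℝ :=
  ∏ i, (D (sx i)).toReal

/-- `H` is properly PAC learnable (realizable case, 0-1 loss): there is a
(randomized) learner emitting hypotheses in `H` and a sample function `m` such
that for all `ε, δ ∈ (0,1)`, all marginals `D`, all ground truths `h* ∈ H`, and
all sample sizes `k ≥ m ε δ`, with probability at least `1 − δ` over the sample
and the learner's randomness, the output has true error at most `ε`. -/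
def ProperlyPACLearnable {X Y : Type*} (H : Set (X → Y)) : Prop :=
  ∃ A : List (X × Y) → PMF H, ∃ m : ℝ → ℝ → ℕ,
    ∀ ε δ : ℝ, 0 < ε → ε < 1 → 0 < δ → δ < 1 →
      ∀ D : PMF X, ∀ hstar ∈ H, ∀ k, m ε δ ≤ k →
        1 - δ ≤ ∑' sx : Fin k → X, sampleProb D k sx *
          ∑' h : H, ((A (List.ofFn fun i => (sx i, hstar (sx i)))) h).toReal *
            (if trueError01 D hstar (↑h) ≤ ε then 1 else 0)

/-- `F` is EMX learnable: there is a (randomized) learner mapping finite tuples in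
`F` to finite subsets of `F` and a sample function `m` such that for all
`ε, δ ∈ (0,1)`, every finitely supported distribution `P` on `F`, and every sample
size `k ≥ m ε δ`, with probability at least `1 − δ` over `S ∼ P^k` and the
learner's randomness, the output set has `P`-measure at least `1 − ε`. -/
def EMXLearnable (F : Type*) : Prop :=
  ∃ G : List F → PMF (Finset F), ∃ m : ℝ → ℝ → ℕ,
    ∀ ε δ : ℝ, 0 < ε → ε < 1 → 0 < δ → δ < 1 →
      ∀ P : PMF F, P.support.Finite → ∀ k, m ε δ ≤ k →
        1 - δ ≤ ∑' sx : Fin k → F, sampleProb P k sx *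
          ∑' T : Finset F, ((G (List.ofFn sx)) T).toReal *
            (if 1 - ε ≤ ∑ f ∈ T, (P f).toReal then 1 else 0)

lemma aux_hasSum_congr {α : Type*} {f g : α → ℝ} {a b : ℝ} (h : HasSum f a)
    (hfg : ∀ x, g x = f x) (hab : b = a) : HasSum g b := by
  obtain rfl : g = f := funext hfg
  rwa [hab]

lemma aux_hasSum_pi {X : Type*} (f : X → ℝ) (s : ℝ) (hf : ∀ x, 0 ≤ f x) (h : HasSum f s) (k : ℕ) :
    HasSum (fun sx : Fin k → X => ∏ i, f (sx i)) (s ^ k) := by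
  induction k with
  | zero =>
    simpa using hasSum_unique (fun sx : Fin 0 → X => ∏ i, f (sx i))
  | succ k ih =>
    have hp : ∀ sx : Fin k → X, 0 ≤ ∏ i, f (sx i) := fun sx => Finset.prod_nonneg fun i _ => hf _
    have h1 : Summable fun x : X × (Fin k → X) => f x.1 * ∏ i, f (x.2 i) :=
      Summable.mul_of_nonneg (f := f) (g := fun sx : Fin k → X => ∏ i, f (sx i))
        h.summable ih.summable hf hp
    have h2 := HasSum.mul (f := f) (g := fun sx : Fin k → X => ∏ i, f (sx i)) h ih h1
    rw [pow_succ']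
    rw [← (Fin.consEquiv (fun _ : Fin (k+1) => X)).hasSum_iff]
    refine aux_hasSum_congr h2 (fun x => ?_) rfl
    simp [Fin.prod_univ_succ, Fin.consEquiv]

lemma aux_pmf_hasSum {X : Type*} (D : PMF X) : HasSum (fun x => (D x).toReal) 1 := by
  have h := ENNReal.hasSum_toReal (f := D) (by rw [D.tsum_coe]; simp)
  rwa [← ENNReal.tsum_toReal_eq D.apply_ne_top, D.tsum_coe, ENNReal.toReal_one] at h

lemma aux_sample_hasSum {X : Type*} (D : PMF X) (k : ℕ) : HasSum (sampleProb D k) 1 := by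
  exact aux_hasSum_congr
    (aux_hasSum_pi _ 1 (fun x => ENNReal.toReal_nonneg) (aux_pmf_hasSum D) k)
    (fun _ => rfl) (by simp)

lemma aux_sample_nonneg {X : Type*} (D : PMF X) (k : ℕ) (sx) : 0 ≤ sampleProb D k sx :=
  Finset.prod_nonneg fun _ _ => ENNReal.toReal_nonneg

/-- probability of an event -/
def auxPr {α : Type*} (p : PMF α) (Q : α → Prop) : ℝ := ∑' a, (p a).toReal * (if Q a then 1 else 0)

lemma aux_pr_summable {α : Type*} (p : PMF α) (Q : α → Prop) :
    Summable fun a => (p a).toReal * (if Q a then (1:ℝ) else 0) := by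
  refine (aux_pmf_hasSum p).summable.of_nonneg_of_le (fun a => ?_) (fun a => ?_) <;> split_ifs <;> simp

lemma aux_pr_nonneg {α : Type*} (p : PMF α) (Q : α → Prop) : 0 ≤ auxPr p Q :=
  tsum_nonneg fun a => by split_ifs <;> simp

lemma aux_pr_mono {α : Type*} (p : PMF α) (Q R : α → Prop) (h : ∀ a, Q a → R a) :
    auxPr p Q ≤ auxPr p R := by
  refine (aux_pr_summable p Q).tsum_le_tsum (fun a => ?_) (aux_pr_summable p R)
  by_cases hQ : Q a
  · simp [hQ, h a hQ]
  · split_ifs <;> simp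

lemma aux_pr_true {α : Type*} (p : PMF α) (Q : α → Prop) (h : ∀ a, Q a) : auxPr p Q = 1 := by
  simpa [auxPr, h] using (aux_pmf_hasSum p).tsum_eq

lemma aux_pr_le_one {α : Type*} (p : PMF α) (Q : α → Prop) : auxPr p Q ≤ 1 := by
  rw [← aux_pr_true p (fun _ => True) (fun _ => trivial)]
  exact aux_pr_mono _ _ _ fun _ _ => trivial

lemma aux_pr_eq {α : Type*} (p : PMF α) (Q : α → Prop) :
    auxPr p Q = (p.toOuterMeasure {a | Q a}).toReal := by
  rw [PMF.toOuterMeasure_apply, ENNReal.tsum_toReal_eq]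
  · refine tsum_congr fun a => ?_
    by_cases h : Q a <;> simp [h]
  · intro a
    by_cases h : Q a <;> simp [h, p.apply_ne_top]

lemma aux_pr_map {α β : Type*} (p : PMF α) (g : α → β) (Q : β → Prop) :
    auxPr (p.map g) Q = auxPr p (fun a => Q (g a)) := by
  rw [aux_pr_eq, aux_pr_eq, PMF.toOuterMeasure_map_apply]; rfl

lemma aux_pr_pure {α : Type*} (a : α) (Q : α → Prop) (h : Q a) :
    auxPr (PMF.pure a) Q = 1 := by
  rw [aux_pr_eq, PMF.toOuterMeasure_pure_apply]; simp [h]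

lemma aux_sum_summable {X : Type*} (D : PMF X) (k : ℕ) (q : (Fin k → X) → ℝ)
    (h0 : ∀ s, 0 ≤ q s) (h1 : ∀ s, q s ≤ 1) : Summable fun s => sampleProb D k s * q s :=
  (aux_sample_hasSum D k).summable.of_nonneg_of_le
    (fun s => mul_nonneg (aux_sample_nonneg D k s) (h0 s))
    (fun s => mul_le_of_le_one_right (aux_sample_nonneg D k s) (h1 s))

/-- The class. -/
abbrev auxH (F : Type*) : Set (F → Option (Set F)) :=
  {f : F → Option (Set F) | ∃ A : Set F, (Aᶜ).Finite ∧
        f = fun x => if x ∈ A then some A else none}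

lemma auxH_fin {F : Type*} (h : auxH F) : {x | h.1 x = none}.Finite := by
  obtain ⟨f, A, hA, rfl⟩ := h
  refine hA.subset fun x hx => ?_
  simpa using hx

/-- hypothesis -/
def auxh {F : Type*} (A : Set F) : F → Option (Set F) := fun x => if x ∈ A then some A else none

lemma aux_mp (F : Type*) (H : ProperlyPACLearnable (auxH F)) : EMXLearnable F := by
  obtain ⟨A, m, hm⟩ := H
  refine ⟨fun L => (A (L.map fun x => (x, none))).map fun h => (auxH_fin h).toFinset, m, ?_⟩
  intro ε δ he he1 hd hd1 P hP k hk
  refine (hm ε δ he he1 hd hd1 P (auxh P.supportᶜ)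
    ⟨P.supportᶜ, by simpa using hP, rfl⟩ k hk).trans ?_
  change ∑' sx : Fin k → F, sampleProb P k sx * auxPr _ _ ≤
    ∑' sx : Fin k → F, sampleProb P k sx * auxPr _ _
  refine Summable.tsum_le_tsum (fun sx => ?_)
    (aux_sum_summable _ _ _ (fun _ => aux_pr_nonneg _ _) (fun _ => aux_pr_le_one _ _))
    (aux_sum_summable _ _ _ (fun _ => aux_pr_nonneg _ _) (fun _ => aux_pr_le_one _ _))
  by_cases h0 : sampleProb P k sx = 0
  · simp [h0]
  refine mul_le_mul_of_nonneg_left ?_ (aux_sample_nonneg _ _ _)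
  have hs : ∀ i, P (sx i) ≠ 0 := by
    intro i hi
    exact h0 (Finset.prod_eq_zero (Finset.mem_univ i) (by simp [hi]))
  rw [aux_pr_map]
  have hL : (List.ofFn fun i => (sx i, auxh P.supportᶜ (sx i)))
      = (List.ofFn sx).map fun x => (x, (none : Option (Set F))) := by
    rw [List.map_ofFn]
    congr 1
    funext i
    simp [auxh, hs i]
  rw [hL]
  refine aux_pr_mono _ _ _ fun h hh => ?_
  have key : trueError01 P (auxh P.supportᶜ) h.1
      = 1 - ∑ f ∈ (auxH_fin h).toFinset, (P f).toReal := by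
    refine HasSum.tsum_eq ?_
    have h1 := (aux_pmf_hasSum P).sub
      (hasSum_sum_of_ne_finset_zero (s := (auxH_fin h).toFinset)
        (f := fun x => if h.1 x = none then (P x).toReal else 0) (by
          intro b hb
          have : h.1 b ≠ none := by simpa using hb
          simp [this]))
    refine aux_hasSum_congr h1 (fun x => ?_) ?_
    · by_cases hx : P x = 0
      · simp [hx]
      · have : x ∉ P.supportᶜ := by simpa using hx
        simp only [auxh, this, if_false]
        split_ifs <;> simp
    · congr 1
      refine Finset.sum_congr rfl fun x hx => ?_
      have : h.1 x = none := by simpa using hx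
      simp [this]
  rw [key] at hh
  linarith

/-- hypothesis with finite star set -/
def auxT {F : Type*} (T : Finset F) : auxH F :=
  ⟨auxh ((T : Set F)ᶜ), (T : Set F)ᶜ, by simp, rfl⟩

/-- learner -/
def auxLearn {F : Type*} (G : List F → PMF (Finset F)) (S : List (F × Option (Set F))) :
    PMF (auxH F) :=
  if h : ∃ A : Set F, (Aᶜ).Finite ∧ ∃ x, (x, some A) ∈ S then
    PMF.pure ⟨auxh h.choose, h.choose, h.choose_spec.1, rfl⟩
  else (G (S.map Prod.fst)).map auxT

lemma aux_err_self {F Y : Type*} (D : PMF F) (h : F → Y) : trueError01 D h h = 0 := by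
  simp [trueError01]

lemma auxLearn_hit {F : Type*} (G : List F → PMF (Finset F)) (A : Set F) (hA : (Aᶜ).Finite)
    {k : ℕ} (sx : Fin k → F) (h : ∃ i, sx i ∈ A) :
    auxLearn G (List.ofFn fun i => (sx i, auxh A (sx i))) = PMF.pure ⟨auxh A, A, hA, rfl⟩ := by
  have hex : ∃ B : Set F, (Bᶜ).Finite ∧
      ∃ x, (x, some B) ∈ List.ofFn fun i => (sx i, auxh A (sx i)) := by
    obtain ⟨i, hi⟩ := h
    refine ⟨A, hA, sx i, ?_⟩
    rw [List.mem_ofFn]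
    exact ⟨i, by simp [auxh, hi]⟩
  have hc : hex.choose = A := by
    obtain ⟨x, hx⟩ := hex.choose_spec.2
    rw [List.mem_ofFn] at hx
    obtain ⟨i, hi⟩ := hx
    have h2 := (Prod.ext_iff.1 hi).2
    simp only [auxh] at h2
    split_ifs at h2
    exact (Option.some.inj h2).symm
  rw [auxLearn, dif_pos hex]
  congr 2
  rw [hc]

lemma auxLearn_miss {F : Type*} (G : List F → PMF (Finset F)) (A : Set F)
    {k : ℕ} (sx : Fin k → F) (h : ∀ i, sx i ∉ A) :
    auxLearn G (List.ofFn fun i => (sx i, auxh A (sx i))) = (G (List.ofFn sx)).map auxT := by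
  rw [auxLearn, dif_neg]
  · rw [List.map_ofFn]; rfl
  · rintro ⟨B, _, x, hx⟩
    rw [List.mem_ofFn] at hx
    obtain ⟨i, hi⟩ := hx
    have h2 := (Prod.ext_iff.1 hi).2
    simp [auxh, h i] at h2

lemma aux_err_T {F : Type*} (D P : PMF F) (A : Set F) (c : ℝ)
    (hP : ∀ x, c * (P x).toReal = if x ∈ A then 0 else (D x).toReal) (T : Finset F) :
    trueError01 D (auxh A) (auxT T).1 ≤ 1 - c * ∑ x ∈ T, (P x).toReal := by
  have h1 := (aux_pmf_hasSum D).sub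
      (hasSum_sum_of_ne_finset_zero (s := T)
        (f := fun x => if x ∈ T then c * (P x).toReal else 0) (by
          intro b hb
          simp [hb]))
  have h2 : ∑ x ∈ T, (if x ∈ T then c * (P x).toReal else 0) = c * ∑ x ∈ T, (P x).toReal := by
    rw [Finset.mul_sum]
    exact Finset.sum_congr rfl fun x hx => by simp [hx]
  rw [h2] at h1
  have hle : ∀ x, (D x).toReal * (if (auxT T).1 x = auxh A x then (0:ℝ) else 1) ≤
      (D x).toReal - (if x ∈ T then c * (P x).toReal else 0) := by
    intro x
    have hn : 0 ≤ (D x).toReal := ENNReal.toReal_nonneg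
    rw [hP]
    by_cases hT : x ∈ T <;> by_cases hxA : x ∈ A <;> simp [auxT, auxh, hT, hxA]
    split_ifs <;> simp
  have hs : Summable fun x => (D x).toReal * (if (auxT T).1 x = auxh A x then (0:ℝ) else 1) := by
    refine (aux_pmf_hasSum D).summable.of_nonneg_of_le (fun a => ?_) (fun a => ?_) <;>
      split_ifs <;> simp
  rw [← h1.tsum_eq]
  refine Summable.tsum_le_tsum (fun x => ?_) ?_ h1.summable
  · refine le_trans (le_of_eq ?_) (hle x)
    congr
  · convert hs

lemma aux_mpr (F : Type*) (H : EMXLearnable F) : ProperlyPACLearnable (auxH F) := by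
  obtain ⟨G, m, hm⟩ := H
  have hK : ∀ ε δ : ℝ, ∃ K : ℕ, 0 < ε → ε < 1 → 0 < δ → (1 - ε/2) ^ K < δ := by
    intro ε δ
    by_cases h : 0 < ε ∧ ε < 1 ∧ 0 < δ
    · obtain ⟨K, hK⟩ := exists_pow_lt_of_lt_one h.2.2 (show 1 - ε/2 < 1 by linarith [h.1])
      exact ⟨K, fun _ _ _ => hK⟩
    · exact ⟨0, fun a b c => absurd ⟨a, b, c⟩ h⟩
  choose K hK using hK
  refine ⟨auxLearn G, fun ε δ => max (m (ε/2) δ) (K ε δ), ?_⟩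
  intro ε δ he he1 hd hd1 D hstar hh k hk
  obtain ⟨A, hA, rfl⟩ := hh
  have hk1 : m (ε/2) δ ≤ k := (le_max_left _ _).trans hk
  have hk2 : K ε δ ≤ k := (le_max_right _ _).trans hk
  change 1 - δ ≤ ∑' sx : Fin k → F, sampleProb D k sx *
    auxPr (auxLearn G (List.ofFn fun i => (sx i, auxh A (sx i))))
      (fun h => trueError01 D (auxh A) h.1 ≤ ε)
  set qD : (Fin k → F) → ℝ := fun sx =>
    auxPr (auxLearn G (List.ofFn fun i => (sx i, auxh A (sx i))))
      (fun h => trueError01 D (auxh A) h.1 ≤ ε) with hqD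
  have hq0 : ∀ s, 0 ≤ qD s := fun s => aux_pr_nonneg _ _
  have hq1 : ∀ s, qD s ≤ 1 := fun s => aux_pr_le_one _ _
  have hhit : ∀ s, (∃ i, s i ∈ A) → qD s = 1 := by
    intro s hs
    simp only [hqD]
    rw [auxLearn_hit G A hA s hs]
    exact aux_pr_pure _ _ (by simp only [aux_err_self]; exact he.le)
  have hsD := aux_sum_summable D k qD hq0 hq1
  have hfail : HasSum (fun s => sampleProb D k s * (1 - qD s))
      (1 - ∑' s, sampleProb D k s * qD s) := by
    have := (aux_sample_hasSum D k).sub hsD.hasSum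
    exact aux_hasSum_congr this (fun s => by ring) rfl
  -- the restricted mass
  set u : F → ℝ := fun x => if x ∈ A then 0 else (D x).toReal with hu
  have hu0 : ∀ x, 0 ≤ u x := fun x => by simp only [hu]; split_ifs <;> simp
  have hule : ∀ x, u x ≤ (D x).toReal := fun x => by simp only [hu]; split_ifs <;> simp
  have hus : Summable u := (aux_pmf_hasSum D).summable.of_nonneg_of_le hu0 hule
  obtain ⟨c, hc⟩ := hus
  have hc0 : 0 ≤ c := hc.nonneg hu0
  have hc1 : c ≤ 1 := hasSum_le hule hc (aux_pmf_hasSum D)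
  have hprod := aux_hasSum_pi u c hu0 hc k
  suffices h : 1 - ∑' s, sampleProb D k s * qD s ≤ δ by
    change 1 - δ ≤ ∑' s, sampleProb D k s * qD s
    linarith
  by_cases hcc : c ≤ 1 - ε/2
  · have h1 : 1 - ∑' s, sampleProb D k s * qD s ≤ c ^ k := by
      refine hasSum_le (fun s => ?_) hfail hprod
      by_cases hs : ∃ i, s i ∈ A
      · rw [hhit s hs]
        simpa using Finset.prod_nonneg fun i _ => hu0 _
      · push Not at hs
        have : ∏ i, u (s i) = sampleProb D k s :=
          Finset.prod_congr rfl fun i _ => by simp [hu, hs i]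
        rw [this]
        exact mul_le_of_le_one_right (aux_sample_nonneg _ _ _) (by linarith [hq0 s])
    have h2 : c ^ k ≤ (1 - ε/2) ^ k := pow_le_pow_left₀ hc0 hcc k
    have h3 : (1 - ε/2) ^ k ≤ (1 - ε/2) ^ (K ε δ) :=
      pow_le_pow_of_le_one (by linarith) (by linarith) hk2
    linarith [hK ε δ he he1 hd]
  · push Not at hcc
    have hcpos : 0 < c := by linarith
    have hPs : HasSum (fun x => ENNReal.ofReal (u x / c)) 1 := by
      have h1 := hc.div_const c
      rw [div_self hcpos.ne'] at h1
      have h2 := ENNReal.ofReal_tsum_of_nonneg (fun x => div_nonneg (hu0 x) hc0) h1.summable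
      rw [h1.tsum_eq, ENNReal.ofReal_one] at h2
      rw [h2]
      exact ENNReal.summable.hasSum
    let P : PMF F := ⟨_, hPs⟩
    have hPx : ∀ x, c * (P x).toReal = u x := by
      intro x
      change c * (ENNReal.ofReal (u x / c)).toReal = u x
      rw [ENNReal.toReal_ofReal (div_nonneg (hu0 x) hc0)]
      field_simp
    have hPf : P.support.Finite := by
      refine hA.subset fun x hx hxA => ?_
      apply (P.mem_support_iff x).1 hx
      change ENNReal.ofReal (u x / c) = 0
      simp [hu, hxA]
    have hG := hm (ε/2) δ (by linarith) (by linarith) hd hd1 P hPf k hk1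
    set qP : (Fin k → F) → ℝ := fun sx => auxPr (G (List.ofFn sx))
      (fun T => 1 - ε/2 ≤ ∑ f ∈ T, (P f).toReal) with hqP
    change 1 - δ ≤ ∑' s, sampleProb P k s * qP s at hG
    have hp0 : ∀ s, 0 ≤ qP s := fun s => aux_pr_nonneg _ _
    have hp1 : ∀ s, qP s ≤ 1 := fun s => aux_pr_le_one _ _
    have hfP : HasSum (fun s => c ^ k * (sampleProb P k s * (1 - qP s)))
        (c ^ k * (1 - ∑' s, sampleProb P k s * qP s)) := by
      have := ((aux_sample_hasSum P k).sub
        (aux_sum_summable P k qP hp0 hp1).hasSum).mul_left (c ^ k)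
      exact aux_hasSum_congr this (fun s => by ring) rfl
    have h1 : 1 - ∑' s, sampleProb D k s * qD s ≤ c ^ k * (1 - ∑' s, sampleProb P k s * qP s) := by
      refine hasSum_le (fun s => ?_) hfail hfP
      by_cases hs : ∃ i, s i ∈ A
      · rw [hhit s hs]
        have := aux_sample_nonneg P k s
        have h5 : 0 ≤ 1 - qP s := by linarith [hp1 s]
        simp only [sub_self, mul_zero]
        positivity
      · push Not at hs
        have h6 : sampleProb D k s = c ^ k * sampleProb P k s := by
          have h7 : c ^ k = ∏ _i : Fin k, c := by simp
          rw [sampleProb, sampleProb, h7, ← Finset.prod_mul_distrib]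
          refine Finset.prod_congr rfl fun i _ => ?_
          rw [hPx]; simp [hu, hs i]
        rw [h6, mul_assoc]
        have h8 : qP s ≤ qD s := by
          simp only [hqD, hqP]
          rw [auxLearn_miss G A s hs, aux_pr_map]
          refine aux_pr_mono _ _ _ fun T hT => ?_
          refine (aux_err_T D P A c hPx T).trans ?_
          nlinarith
        have := aux_sample_nonneg P k s
        gcongr
    have h2 : c ^ k ≤ 1 := pow_le_one₀ hc0 hc1
    have h3 : 0 ≤ c ^ k := pow_nonneg hc0 k
    nlinarith

/-- **EMX learning embeds into proper multiclass learning.** For any set `F`, the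
class `H = {h_A : A ⊆ F, F \ A finite}` over domain `X = F` and labels
`Y = {⋆} ∪ 2^F` — where `h_A(x) = A` if `x ∈ A` and `h_A(x) = ⋆` otherwise — is
properly PAC learnable (under 0-1 loss) if and only if `F` is EMX learnable. -/
theorem properly_learnable_iff_emx (F : Type*) :
    ProperlyPACLearnable
      {f : F → Option (Set F) | ∃ A : Set F, (Aᶜ).Finite ∧
        f = fun x => if x ∈ A then some A else none}
      ↔ EMXLearnable F := by
  exact ⟨aux_mp F, aux_mpr F⟩
end
end

section
/- In multiclass classification under the 0-1 loss, proper PAC learnability is not a local property: there exist a domain X, a label set Y, and hypothesis classes H, H' ⊆ Y^X such that H|_S = H'|_S for every finite subset S ⊆ X, yet H' is properly PAC learnable and H is not properly PAC learnable. -/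
noncomputable section
open scoped ENNReal Classical

/-- The hypothesis with value `A` on `A` and the blank label `∅` elsewhere. -/
def blkHyp {X : Type} (A : Set X) : X → Set X := fun x => if x ∈ A then A else ∅

/-- Kuratowski-type free set lemma for countable set mappings. -/
lemma exists_free_set {X : Type} (n : ℕ) : ∀ (Z : Set X) (g : Finset X → Set X),
    Cardinal.aleph n ≤ Cardinal.mk Z → (∀ T, (g T).Countable) →
    ∃ F : Finset X, ↑F ⊆ Z ∧ F.card = n ∧ ∀ x ∈ F, x ∉ g (F.erase x) := by
  induction n with
  | zero => 
    intro Z g _ _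
    exact ⟨∅, by simp, by simp, by simp⟩
  | succ n ih =>
    intro Y g hY hg
    have hlt : Cardinal.aleph (n : Ordinal) < Cardinal.aleph ((n + 1 : ℕ) : Ordinal) := by
      rw [Cardinal.aleph_lt_aleph]
      exact_mod_cast Nat.lt_succ_self n
    obtain ⟨Z, hZY, hZ⟩ := Cardinal.le_mk_iff_exists_subset.1 (hlt.le.trans hY)
    have hinf : Infinite Z := by
      rw [Cardinal.infinite_iff, hZ]
      exact Cardinal.aleph0_le_aleph _
    let C : Set X := ⋃ T : Finset Z, g (T.map (Function.Embedding.subtype _))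
    have hC : Cardinal.mk C ≤ Cardinal.aleph n := by
      refine (Cardinal.mk_iUnion_le _).trans ?_
      rw [Cardinal.mk_finset_of_infinite, hZ]
      refine (mul_le_mul' le_rfl (ciSup_le' (a := Cardinal.aleph0) fun T => ?_)).trans ?_
      · exact Cardinal.mk_le_aleph0_iff.2 (hg _)
      · exact Cardinal.mul_le_of_le (Cardinal.aleph0_le_aleph _) le_rfl
          (Cardinal.aleph0_le_aleph _)
    have hZC : Cardinal.mk (Z ∪ C : Set X) ≤ Cardinal.aleph n := by
      refine (Cardinal.mk_union_le _ _).trans ?_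
      exact Cardinal.add_le_of_le (Cardinal.aleph0_le_aleph _) hZ.le hC
    obtain ⟨y, hyY, hy⟩ : ∃ y ∈ Y, y ∉ Z ∪ C := by
      by_contra! hcon
      exact absurd ((hY.trans (Cardinal.mk_le_mk_of_subset hcon)).trans hZC) (not_le.2 hlt)
    obtain ⟨F, hFZ, hFc, hF⟩ := ih Z (fun T => g (insert y T)) hZ.ge (fun T => hg _)
    have hyF : y ∉ F := fun h => hy (Or.inl (hFZ h))
    refine ⟨insert y F, ?_, ?_, ?_⟩
    · intro x hx
      rcases Finset.mem_insert.1 (Finset.mem_coe.1 hx) with rfl | hx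
      · exact hyY
      · exact hZY (hFZ hx)
    · rw [Finset.card_insert_of_notMem hyF, hFc]
    · intro x hx
      rcases Finset.mem_insert.1 hx with rfl | hx
      · rw [Finset.erase_insert hyF]
        intro h
        refine hy (Or.inr (Set.mem_iUnion.2 ⟨F.subtype (· ∈ Z), ?_⟩))
        rwa [Finset.subtype_map_of_mem (fun a ha => hFZ ha)]
      · rw [Finset.erase_insert_of_ne (fun h : y = x => hyF (by rw [h]; exact hx))]
        exact hF x hx

lemma hasSum_prod_pow {X : Type} (f : X → ℝ) (s : ℝ) (hf : ∀ x, 0 ≤ f x) (hs : HasSum f s)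
    (k : ℕ) : HasSum (fun sx : Fin k → X => ∏ i, f (sx i)) (s ^ k) := by
  induction k with
  | zero => simp
  | succ k ih =>
    have hn : ∀ sx : Fin k → X, 0 ≤ ∏ i, f (sx i) := fun sx => Finset.prod_nonneg fun i _ => hf _
    have h0 : Summable fun p : X × (Fin k → X) => f p.1 * ∏ i, f (p.2 i) :=
      Summable.mul_of_nonneg (f := f) (g := fun sx : Fin k → X => ∏ i, f (sx i))
        hs.summable ih.summable (Pi.le_def.2 hf) (Pi.le_def.2 hn)
    have h1 : HasSum (fun p : X × (Fin k → X) => f p.1 * ∏ i, f (p.2 i)) (s * s ^ k) :=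
      HasSum.mul (f := f) (g := fun sx : Fin k → X => ∏ i, f (sx i)) hs ih h0
    rw [← (Fin.consEquiv (fun _ : Fin (k + 1) => X)).hasSum_iff]
    rw [pow_succ']
    have h2 : ((fun sx : Fin (k + 1) → X => ∏ i, f (sx i)) ∘
        (Fin.consEquiv (fun _ : Fin (k + 1) => X))) =
        fun p : X × (Fin k → X) => f p.1 * ∏ i, f (p.2 i) := by
      funext p
      simp [Fin.prod_univ_succ, Fin.consEquiv]
    rw [h2]
    exact h1

lemma pmf_hasSum {X : Type} (D : PMF X) : HasSum (fun x => (D x).toReal) 1 := by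
  have h := ENNReal.hasSum_toReal (f := fun x => D x) (by rw [D.tsum_coe]; simp)
  rwa [← ENNReal.tsum_toReal_eq (fun x => D.apply_ne_top x), D.tsum_coe] at h

lemma not_learnable {X : Type} (hX : ∀ n : ℕ, Cardinal.aleph n ≤ Cardinal.mk X) :
    ¬ ProperlyPACLearnable {h : X → Set X | ∃ A : Set X, Aᶜ.Finite ∧ h = blkHyp A} := by
  have hinf : Infinite X := by
    rw [Cardinal.infinite_iff]
    exact (Cardinal.aleph0_le_aleph _).trans (hX 0)
  rintro ⟨L, m, hL⟩
  have hL := hL (1/4) (1/2) (by norm_num) (by norm_num) (by norm_num) (by norm_num)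
  set k := m (1/4) (1/2) with hk
  let g : Finset X → Set X := fun T => ⋃ sx : Fin k → T,
    ⋃ h ∈ (L (List.ofFn fun i => ((sx i : X), (∅ : Set X)))).support, {x | h.1 x = ∅}
  have hg : ∀ T, (g T).Countable := by
    intro T
    refine Set.countable_iUnion fun sx => ?_
    refine Set.Countable.biUnion (PMF.support_countable _) ?_
    rintro ⟨h, A, hA, rfl⟩ -
    refine (hA.subset ?_).countable
    intro x hx hxA
    simp only [blkHyp, if_pos hxA, Set.mem_ofPred_eq] at hx
    rw [hx] at hxA
    exact hxA
  obtain ⟨F, -, hFc, hF⟩ := exists_free_set (2 * k + 2) Set.univ g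
    (by rw [Cardinal.mk_univ]; exact hX _) hg
  have hFne : F.Nonempty := by
    rw [← Finset.card_pos]; omega
  have hD := hL (PMF.uniformOfFinset F hFne) (blkHyp (↑F)ᶜ)
    ⟨_, by simp, rfl⟩ k le_rfl
  have hstar : ∀ x ∈ F, blkHyp ((↑F : Set X)ᶜ) x = ∅ := by
    intro x hx
    simp [blkHyp, hx]
  rw [tsum_congr (g := fun _ => (0 : ℝ)), tsum_zero] at hD
  · norm_num at hD
  intro sx
  by_cases hsx : ∀ i, sx i ∈ F
  swap
  · push Not at hsx
    obtain ⟨i, hi⟩ := hsx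
    have : sampleProb (PMF.uniformOfFinset F hFne) k sx = 0 := by
      refine Finset.prod_eq_zero (Finset.mem_univ i) ?_
      rw [PMF.uniformOfFinset_apply_of_notMem hFne hi]
      simp
    rw [this, zero_mul]
  · rw [tsum_congr (g := fun _ => (0 : ℝ)), tsum_zero, mul_zero]
    intro h
    by_cases hs : h ∈ (L (List.ofFn fun i => (sx i, blkHyp ((↑F : Set X)ᶜ) (sx i)))).support
    swap
    · rw [PMF.mem_support_iff, not_not] at hs
      rw [hs]
      simp
    have key : ∀ x ∈ F \ Finset.univ.image sx, h.1 x ≠ blkHyp ((↑F : Set X)ᶜ) x := by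
      intro x hx heq
      rw [Finset.mem_sdiff] at hx
      rw [hstar x hx.1] at heq
      refine hF x hx.1 ?_
      have hT : ∀ i, sx i ∈ F.erase x := fun i => Finset.mem_erase.2
        ⟨fun h => hx.2 (Finset.mem_image.2 ⟨i, Finset.mem_univ _, h⟩), hsx i⟩
      refine Set.mem_iUnion.2 ⟨fun i => ⟨sx i, hT i⟩, ?_⟩
      refine Set.mem_iUnion₂.2 ⟨h, ?_, heq⟩
      simpa only [hstar _ (hsx _)] using hs
    have herr : ¬ trueError01 (PMF.uniformOfFinset F hFne) (blkHyp ((↑F : Set X)ᶜ)) h.1 ≤ 1/4 := by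
      rw [not_le]
      unfold trueError01
      rw [tsum_eq_sum (s := F)]
      swap
      · intro x hx
        rw [PMF.uniformOfFinset_apply_of_notMem hFne hx]
        simp
      have hcard : k + 2 ≤ (F \ Finset.univ.image sx).card := by
        have h1 := Finset.le_card_sdiff (Finset.univ.image sx) F
        have h2 : (Finset.univ.image sx).card ≤ k := by
          simpa using Finset.card_image_le (s := Finset.univ) (f := sx)
        omega
      have hcard' : (k : ℝ) + 2 ≤ ((F \ Finset.univ.image sx).card : ℝ) := by exact_mod_cast hcard
      calc (1/4 : ℝ) < (k + 2) * (2 * k + 2 : ℝ)⁻¹ := by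
            rw [← div_eq_mul_inv, lt_div_iff₀ (by positivity)]
            linarith [(Nat.cast_nonneg k : (0:ℝ) ≤ k)]
        _ ≤ ((F \ Finset.univ.image sx).card : ℝ) * (2 * k + 2 : ℝ)⁻¹ := by gcongr
        _ = ∑ x ∈ F \ Finset.univ.image sx, (2 * k + 2 : ℝ)⁻¹ := by
            rw [Finset.sum_const, nsmul_eq_mul]
        _ = ∑ x ∈ F \ Finset.univ.image sx, ((PMF.uniformOfFinset F hFne) x).toReal *
              (if h.1 x = blkHyp ((↑F : Set X)ᶜ) x then 0 else 1) := by
            refine Finset.sum_congr rfl fun x hx => ?_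
            rw [if_neg (key x hx), mul_one,
              PMF.uniformOfFinset_apply_of_mem hFne (Finset.mem_sdiff.1 hx).1, hFc,
              ENNReal.toReal_inv, ENNReal.toReal_natCast]
            push_cast
            rfl
        _ ≤ _ := by
            refine Finset.sum_le_sum_of_subset_of_nonneg Finset.sdiff_subset fun x _ _ => ?_
            positivity
    rw [if_neg herr, mul_zero]

lemma learnable {X : Type} (H : Set (X → Set X)) (h0 : blkHyp ∅ ∈ H)
    (hH : ∀ h ∈ H, ∃ A : Set X, h = blkHyp A) : ProperlyPACLearnable H := by
  let out : List (X × Set X) → H := fun l =>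
    if hl : ∃ p ∈ l, p.2 ≠ ∅ ∧ blkHyp p.2 ∈ H then ⟨blkHyp hl.choose.2, hl.choose_spec.2.2⟩
    else ⟨blkHyp ∅, h0⟩
  have hm : ∀ ε δ : ℝ, ∃ n : ℕ, 0 < ε → ε < 1 → 0 < δ → (1 - ε) ^ n < δ := by
    intro ε δ
    by_cases h : 0 < ε ∧ 0 < δ
    · obtain ⟨n, hn⟩ := exists_pow_lt_of_lt_one h.2 (show 1 - ε < 1 by linarith)
      exact ⟨n, fun _ _ _ => hn⟩
    · exact ⟨0, fun h1 _ h2 => absurd ⟨h1, h2⟩ h⟩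
  choose m hm using hm
  refine ⟨fun l => PMF.pure (out l), m, ?_⟩
  intro ε δ hε hε1 hδ hδ1 D hstar hstarH k hk
  obtain ⟨A, rfl⟩ := hH _ hstarH
  have hin : ∀ sx : Fin k → X,
      (∑' h : H, ((PMF.pure (out (List.ofFn fun i => (sx i, blkHyp A (sx i))))) h).toReal *
            (if trueError01 D (blkHyp A) (↑h) ≤ ε then (1 : ℝ) else 0)) =
      if trueError01 D (blkHyp A) (out (List.ofFn fun i => (sx i, blkHyp A (sx i)))).1 ≤ ε
        then 1 else 0 := by
    intro sx
    rw [tsum_eq_single (out (List.ofFn fun i => (sx i, blkHyp A (sx i))))]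
    · simp [PMF.pure_apply]
    · intro h hne
      simp [PMF.pure_apply, hne]
  simp only [hin]
  -- the output on a sample that hits, or does not hit, `A`
  have hit : ∀ sx : Fin k → X, (∃ i, sx i ∈ A) →
      (out (List.ofFn fun i => (sx i, blkHyp A (sx i)))).1 = blkHyp A := by
    rintro sx ⟨i, hi⟩
    have hl : ∃ p ∈ (List.ofFn fun i => (sx i, blkHyp A (sx i))), p.2 ≠ ∅ ∧ blkHyp p.2 ∈ H := by
      refine ⟨(sx i, blkHyp A (sx i)), (List.mem_ofFn' _ _).2 ⟨i, rfl⟩, ?_⟩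
      have : blkHyp A (sx i) = A := if_pos hi
      simp only [this]
      exact ⟨Set.Nonempty.ne_empty ⟨_, hi⟩, hstarH⟩
    simp only [out, dif_pos hl]
    have h1 := hl.choose_spec
    obtain ⟨j, hj⟩ := (List.mem_ofFn' _ _).1 h1.1
    have h2 := h1.2.1
    have h3 : hl.choose.2 = blkHyp A (sx j) := by rw [← hj]
    by_cases hjA : sx j ∈ A
    · rw [h3, show blkHyp A (sx j) = A from if_pos hjA]
    · exact absurd (h3.trans (if_neg hjA)) h2
  have miss : ∀ sx : Fin k → X, (¬ ∃ i, sx i ∈ A) →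
      (out (List.ofFn fun i => (sx i, blkHyp A (sx i)))).1 = blkHyp ∅ := by
    intro sx hno
    have hl : ¬ ∃ p ∈ (List.ofFn fun i => (sx i, blkHyp A (sx i))), p.2 ≠ ∅ ∧ blkHyp p.2 ∈ H := by
      rintro ⟨p, hp, hp2, -⟩
      obtain ⟨j, rfl⟩ := (List.mem_ofFn' _ _).1 hp
      exact hp2 (if_neg fun h => hno ⟨j, h⟩)
    simp only [out, dif_neg hl]
  have herr0 : trueError01 D (blkHyp A) (blkHyp A) = 0 := by simp [trueError01]
  have hD := pmf_hasSum D
  have hS := hasSum_prod_pow _ _ (fun x => ENNReal.toReal_nonneg) hD k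
  rw [one_pow] at hS
  have hSn : ∀ sx : Fin k → X, 0 ≤ ∏ i, (D (sx i)).toReal :=
    fun sx => Finset.prod_nonneg fun i _ => ENNReal.toReal_nonneg
  let f : X → ℝ := fun x => (D x).toReal * (if blkHyp ∅ x = blkHyp A x then 1 else 0)
  have hfn : ∀ x, 0 ≤ f x := fun x => by positivity
  have hfle : ∀ x, f x ≤ (D x).toReal := fun x => by
    simp only [f]; split_ifs <;> simp
  have hfs : Summable f := Summable.of_nonneg_of_le hfn hfle hD.summable
  have hsplit : trueError01 D (blkHyp A) (blkHyp ∅) = 1 - ∑' x, f x := by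
    rw [← hD.tsum_eq, ← hD.summable.tsum_sub hfs]
    refine tsum_congr fun x => ?_
    simp only [f]; split_ifs <;> simp
  have hP := hasSum_prod_pow f _ hfn hfs.hasSum k
  have hind : ∀ sx : Fin k → X, 0 ≤ sampleProb D k sx * (if trueError01 D (blkHyp A)
      (out (List.ofFn fun i => (sx i, blkHyp A (sx i)))).1 ≤ ε then (1 : ℝ) else 0) := fun sx =>
    mul_nonneg (hSn sx) (by positivity)
  have hsum : Summable fun sx : Fin k → X => sampleProb D k sx * (if trueError01 D (blkHyp A)
      (out (List.ofFn fun i => (sx i, blkHyp A (sx i)))).1 ≤ ε then (1 : ℝ) else 0) := by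
    refine Summable.of_nonneg_of_le hind (fun sx => ?_) hS.summable
    refine mul_le_of_le_one_right (hSn sx) ?_
    split_ifs <;> simp
  by_cases hc : trueError01 D (blkHyp A) (blkHyp ∅) ≤ ε
  · have : (1 : ℝ) ≤ ∑' sx : Fin k → X, sampleProb D k sx * (if trueError01 D (blkHyp A)
      (out (List.ofFn fun i => (sx i, blkHyp A (sx i)))).1 ≤ ε then (1 : ℝ) else 0) := by
      refine hS.tsum_eq.symm.le.trans ?_
      refine hS.summable.tsum_le_tsum (fun sx => ?_) hsum
      rw [if_pos, mul_one]
      · rfl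
      · by_cases h : ∃ i, sx i ∈ A
        · rw [hit sx h, herr0]; exact hε.le
        · rw [miss sx h]; exact hc
    linarith
  · have hle : 1 - (∑' x, f x) ^ k ≤ ∑' sx : Fin k → X, sampleProb D k sx *
      (if trueError01 D (blkHyp A)
      (out (List.ofFn fun i => (sx i, blkHyp A (sx i)))).1 ≤ ε then (1 : ℝ) else 0) := by
      rw [← (hS.sub hP).tsum_eq]
      refine (hS.sub hP).summable.tsum_le_tsum (fun sx => ?_) hsum
      by_cases h : ∃ i, sx i ∈ A
      · rw [hit sx h, herr0, if_pos hε.le, mul_one]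
        exact sub_le_self _ (Finset.prod_nonneg fun i _ => hfn _)
      · refine le_trans (le_of_eq ?_) (hind sx)
        rw [sub_eq_zero]
        refine Finset.prod_congr rfl fun i _ => ?_
        have hi : sx i ∉ A := fun hi => h ⟨i, hi⟩
        simp [f, blkHyp, hi]
    have hf0 : 0 ≤ ∑' x, f x := tsum_nonneg hfn
    have h1 : (∑' x, f x) ^ k ≤ (1 - ε) ^ k := pow_le_pow_left₀ hf0 (by linarith) k
    have h2 : (1 - ε) ^ k ≤ (1 - ε) ^ m ε δ :=
      pow_le_pow_of_le_one (by linarith) (by linarith) hk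
    have h3 := hm ε δ hε hε1 hδ
    linarith

/-- **Proper PAC learnability is not a local property.** There exist a domain `X`,
a label set `Y`, and classes `H, H' ⊆ Y^X` with the same restriction to every
finite subset of `X`, such that `H'` is properly PAC learnable while `H` is not. -/
theorem proper_learnability_not_local :
    ∃ (X Y : Type) (H H' : Set (X → Y)),
      (∀ S : Finset X,
        (fun h : X → Y => fun x : {x // x ∈ S} => h x.val) '' H =
          (fun h : X → Y => fun x : {x // x ∈ S} => h x.val) '' H') ∧
      ProperlyPACLearnable H' ∧ ¬ ProperlyPACLearnable H := by
  let X : Type := (Cardinal.aleph Ordinal.omega0).out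
  have hX : ∀ n : ℕ, Cardinal.aleph n ≤ Cardinal.mk X := by
    intro n
    rw [Cardinal.mk_out, Cardinal.aleph_le_aleph]
    exact (Ordinal.natCast_lt_omega0 n).le
  refine ⟨X, Set X, {h | ∃ A : Set X, Aᶜ.Finite ∧ h = blkHyp A},
    insert (blkHyp ∅) {h | ∃ A : Set X, Aᶜ.Finite ∧ h = blkHyp A}, ?_, ?_, not_learnable hX⟩
  · intro S
    rw [Set.image_insert_eq, Set.insert_eq_of_mem]
    refine ⟨blkHyp (↑S)ᶜ, ⟨_, by simp, rfl⟩, ?_⟩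
    funext x
    simp [blkHyp]
  · refine learnable _ (Set.mem_insert _ _) ?_
    rintro h (rfl | ⟨A, -, rfl⟩)
    · exact ⟨_, rfl⟩
    · exact ⟨_, rfl⟩
end
end
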